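/- Let n ≥ 3, let 1 ≤ a < b < n−a, let η = e^{2πi/n}, and let D ∈ ℂ[X] be the polynomial with (X−η^{a})(X−η^{−a})(X−η^{b})(X−η^{−b})·D(X) = ((η^{a}+η^{−a}−η^{b}−η^{−b})/n)·X(X²−1)(X^{n}−1). Then D(η^{a}) = D(η^{−a}) = 1. -/

import Mathlib

open Polynomial

lemma I2ab_aux (n : ℕ) (hn : 3 ≤ n) (x y : ℂ) (hx : x ≠ 0) (hy : y ≠ 0) (hxn : x ^ n = 1)
    (h1 : x * x ≠ 1) (h2 : x ≠ y) (h3 : x * y ≠ 1) (D : ℂ[X])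
    (hD : (X - C x) * (X - C (x⁻¹)) * (X - C y) * (X - C (y⁻¹)) * D =
      C ((x + x⁻¹ - y - y⁻¹) / (n : ℂ)) * (X * (X ^ 2 - 1) * (X ^ n - 1))) :
    D.eval x = 1 := by
  have hn0 : (n : ℂ) ≠ 0 := by
    have : n ≠ 0 := by omega
    exact_mod_cast this
  have h := congrArg (fun p => (derivative p).eval x) hD
  have hp : x ^ (n - 1) * x = 1 := by
    rw [← pow_succ, Nat.sub_add_cancel (by omega), hxn]
  simp only [derivative_mul, derivative_sub, derivative_X, derivative_C, derivative_X_pow,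
    derivative_one, eval_add, eval_mul, eval_sub, eval_X, eval_C, eval_one, eval_zero, eval_pow,
    hxn, sub_self, zero_mul, mul_zero, add_zero, zero_add, sub_zero, one_mul,
    eval_natCast, map_natCast] at h
  have e : (x * x - 1) * (x - y) * (x * y - 1) * D.eval x
      = (x * x - 1) * (x - y) * (x * y - 1) := by
    have hR : (x + x⁻¹ - y - y⁻¹) / (n : ℂ) * (x * (x ^ 2 - 1) * (n * x ^ (n - 1)))
        = (x + x⁻¹ - y - y⁻¹) * (x ^ 2 - 1) := by
      field_simp
      linear_combination (x * y * (x - y) + y - x) * (x ^ 2 - 1) * hp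
    rw [hR] at h
    field_simp at h
    linear_combination h
  have hne : (x * x - 1) * (x - y) * (x * y - 1) ≠ 0 :=
    mul_ne_zero (mul_ne_zero (sub_ne_zero.2 h1) (sub_ne_zero.2 h2)) (sub_ne_zero.2 h3)
  exact mul_left_cancel₀ hne (by rw [e, mul_one])

/-- For `n ≥ 3`, `1 ≤ a < b < n−a`, `η = e^{2πi/n}`, and `D` the generic degree of
`I₂(n)[a,b]`, one has `D(ηᵃ) = D(η⁻ᵃ) = 1`. -/
theorem I2ab_plus_type (n : ℕ) (hn : 3 ≤ n) (a b : ℕ) (ha : 1 ≤ a) (hab : a < b)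
    (hb : a + b < n) (η : ℂ) (hη : η = Complex.exp (2 * Real.pi * Complex.I / (n : ℂ)))
    (D : ℂ[X])
    (hD : (X - C (η ^ a)) * (X - C ((η ^ a)⁻¹)) * (X - C (η ^ b)) * (X - C ((η ^ b)⁻¹)) * D =
      C ((η ^ a + (η ^ a)⁻¹ - η ^ b - (η ^ b)⁻¹) / (n : ℂ)) *
        (X * (X ^ 2 - 1) * (X ^ n - 1))) :
    D.eval (η ^ a) = 1 ∧ D.eval ((η ^ a)⁻¹) = 1 := by
  have hp : IsPrimitiveRoot η n := hη ▸ Complex.isPrimitiveRoot_exp n (by omega)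
  have h0 : η ≠ 0 := hp.ne_zero (by omega)
  have hx : η ^ a ≠ 0 := pow_ne_zero _ h0
  have hy : η ^ b ≠ 0 := pow_ne_zero _ h0
  have hxn : (η ^ a) ^ n = 1 := by rw [← pow_mul, mul_comm, pow_mul, hp.pow_eq_one, one_pow]
  have h1 : η ^ a * η ^ a ≠ 1 := by
    rw [← pow_add]; exact hp.pow_ne_one_of_pos_of_lt (by omega) (by omega)
  have h2 : η ^ a ≠ η ^ b := fun h => by
    have := hp.pow_inj (by omega) (by omega) h
    omega
  have h3 : η ^ a * η ^ b ≠ 1 := by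
    rw [← pow_add]; exact hp.pow_ne_one_of_pos_of_lt (by omega) (by omega)
  generalize η ^ a = x at *
  generalize η ^ b = y at *
  refine ⟨I2ab_aux n hn x y hx hy hxn h1 h2 h3 D hD,
    I2ab_aux n hn x⁻¹ y (inv_ne_zero hx) hy (by rw [inv_pow, hxn, inv_one]) ?_ ?_ ?_ D ?_⟩
  · rw [← mul_inv]; exact fun h => h1 (inv_eq_one.1 h)
  · intro h; apply h3; rw [← h, mul_inv_cancel₀ hx]
  · intro h; apply h2; field_simp at h; exact h.symm
  · rw [inv_inv, add_comm x⁻¹ x, ← hD]; ring
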